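/- Let 0 < r < R and 0 < r_* < R_*. Define f₂ : A(r,R) → ℝ³ by f₂(x) = R_* (r_*/R_*)^{R(|x|−r)/((R−r)|x|)} · x/|x|. Then f₂ is a C^1 homeomorphism of A(r,R) onto A(r_*,R_*), and ∫_{A(r,R)} ‖Df₂(x)‖²/|f₂(x)|² dx = 4π( 2(R−r) + rR (log(R_*/r_*))²/(R−r) ). -/

import Mathlib

open MeasureTheory Set
open scoped ENNReal RealInnerProductSpace

noncomputable section

abbrev E3 := EuclideanSpace ℝ (Fin 3)

/-- The open spherical annulus `{x : a < |x| < b}` in `ℝ³`. -/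
def ann (a b : ℝ) : Set E3 := {x | a < ‖x‖ ∧ ‖x‖ < b}

/-- Squared Frobenius (Hilbert–Schmidt) norm of a linear map on `ℝ³`. -/
def frobSq (L : E3 →L[ℝ] E3) : ℝ := ∑ i : Fin 3, ‖L (EuclideanSpace.single i 1)‖ ^ 2

/-- The radial map of `ℝ³` with radial profile `ρ`. -/
def radialMap (ρ : ℝ → ℝ) (x : E3) : E3 := ρ ‖x‖ • (‖x‖⁻¹ • x)

lemma norm_radialMap {ρ : ℝ → ℝ} {x : E3} (hx : x ≠ 0) (hρ : 0 ≤ ρ ‖x‖) :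
    ‖radialMap ρ x‖ = ρ ‖x‖ := by
  rw [radialMap, norm_smul, norm_smul, norm_inv, norm_norm,
    inv_mul_cancel₀ (norm_ne_zero_iff.2 hx), mul_one, Real.norm_of_nonneg hρ]

lemma ne_zero_of_mem_ann {a b : ℝ} (ha : 0 ≤ a) {x : E3} (hx : x ∈ ann a b) : x ≠ 0 :=
  norm_pos_iff.1 (ha.trans_lt hx.1)

lemma isOpen_ann (a b : ℝ) : IsOpen (ann a b) :=
  (isOpen_lt continuous_const continuous_norm).inter (isOpen_lt continuous_norm continuous_const)

lemma mapsTo_radialMap {ρ : ℝ → ℝ} {a b c d : ℝ} (ha : 0 ≤ a) (hc : 0 ≤ c)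
    (h : MapsTo ρ (Ioo a b) (Ioo c d)) : MapsTo (radialMap ρ) (ann a b) (ann c d) := by
  intro x hx
  have hm : ρ ‖x‖ ∈ Ioo c d := h hx
  change c < ‖radialMap ρ x‖ ∧ ‖radialMap ρ x‖ < d
  rw [norm_radialMap (ne_zero_of_mem_ann ha hx) (hc.trans hm.1.le)]
  exact hm

lemma leftInvOn_radialMap {ρ τ : ℝ → ℝ} {a b c d : ℝ} (ha : 0 ≤ a) (hc : 0 ≤ c)
    (hm : MapsTo ρ (Ioo a b) (Ioo c d)) (h : LeftInvOn τ ρ (Ioo a b)) :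
    LeftInvOn (radialMap τ) (radialMap ρ) (ann a b) := by
  intro x hx
  have hx0 := ne_zero_of_mem_ann ha hx
  have hρ : 0 < ρ ‖x‖ := hc.trans_lt (hm hx).1
  have hn : ‖x‖ ≠ 0 := norm_ne_zero_iff.2 hx0
  rw [radialMap, norm_radialMap hx0 hρ.le, h hx, radialMap, smul_smul, smul_smul, smul_smul]
  have : ‖x‖ * (ρ ‖x‖)⁻¹ * ρ ‖x‖ * ‖x‖⁻¹ = 1 := by
    field_simp
  rw [this, one_smul]

lemma contDiffOn_radialMap {ρ : ℝ → ℝ} {a b : ℝ} {n : WithTop ℕ∞} (ha : 0 ≤ a)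
    (h : ContDiffOn ℝ n ρ (Ioo a b)) : ContDiffOn ℝ n (radialMap ρ) (ann a b) := by
  have hn : ContDiffOn ℝ n (fun x : E3 => ‖x‖) (ann a b) := fun x hx =>
    (contDiffAt_norm ℝ (ne_zero_of_mem_ann ha hx)).contDiffWithinAt
  exact (h.comp hn fun x hx => hx).smul
    ((hn.inv fun x hx => norm_ne_zero_iff.2 (ne_zero_of_mem_ann ha hx)).smul contDiffOn_id)

lemma continuousOn_radialMap {ρ : ℝ → ℝ} {a b : ℝ} (ha : 0 ≤ a)
    (h : ContinuousOn ρ (Ioo a b)) : ContinuousOn (radialMap ρ) (ann a b) :=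
  contDiffOn_zero.1 (contDiffOn_radialMap ha (contDiffOn_zero.2 h))

lemma hasFDerivAt_norm_of_ne_zero {x : E3} (hx : x ≠ 0) :
    HasFDerivAt (fun y : E3 => ‖y‖) (‖x‖⁻¹ • innerSL ℝ x) x := by
  have h := (hasStrictFDerivAt_norm_sq x).hasFDerivAt.sqrt
    (pow_ne_zero 2 (norm_ne_zero_iff.2 hx))
  simp only [Real.sqrt_sq (norm_nonneg _)] at h
  refine h.congr_fderiv ?_
  rw [← Nat.cast_smul_eq_nsmul ℝ, smul_smul]
  congr 1
  push_cast
  ring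

lemma hasFDerivAt_norm_smul_self {φ : ℝ → ℝ} {φ' : ℝ} {x : E3} (hx : x ≠ 0)
    (h : HasDerivAt φ φ' ‖x‖) :
    HasFDerivAt (fun y : E3 => φ ‖y‖ • y) (φ ‖x‖ • ContinuousLinearMap.id ℝ E3 +
      (φ' • (‖x‖⁻¹ • innerSL ℝ x)).smulRight x) x :=
  (h.comp_hasFDerivAt x (hasFDerivAt_norm_of_ne_zero hx)).smul (hasFDerivAt_id x)

lemma frobSq_smul_id_add_smulRight (a b : ℝ) (x : E3) :
    frobSq (a • ContinuousLinearMap.id ℝ E3 + (b • innerSL ℝ x).smulRight x) =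
      2 * a ^ 2 + (a + b * ‖x‖ ^ 2) ^ 2 := by
  simp only [frobSq, EuclideanSpace.norm_sq_eq, Fin.sum_univ_three]
  simp [EuclideanSpace.inner_single_right, sq_abs, mul_pow]
  ring

lemma frobSq_fderiv_radialMap {ρ : ℝ → ℝ} {ρ' : ℝ} {x : E3} (hx : x ≠ 0)
    (h : HasDerivAt ρ ρ' ‖x‖) :
    frobSq (fderiv ℝ (radialMap ρ) x) = ρ' ^ 2 + 2 * (ρ ‖x‖ / ‖x‖) ^ 2 := by
  have hn : ‖x‖ ≠ 0 := norm_ne_zero_iff.2 hx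
  have hφ : HasDerivAt (fun t => ρ t / t) ((ρ' * ‖x‖ - ρ ‖x‖ * 1) / ‖x‖ ^ 2) ‖x‖ :=
    h.div (hasDerivAt_id ‖x‖) hn
  have hd := hasFDerivAt_norm_smul_self hx hφ
  have he : radialMap ρ = fun y : E3 => (fun t => ρ t / t) ‖y‖ • y := by
    funext y
    simp [radialMap, smul_smul, div_eq_mul_inv]
  rw [he, hd.fderiv, smul_smul, frobSq_smul_id_add_smulRight]
  field_simp
  ring

lemma setIntegral_ann_fun_norm {a b : ℝ} (ha : 0 ≤ a) (G : ℝ → ℝ) :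
    ∫ x in ann a b, G ‖x‖ = 4 * Real.pi * ∫ t in Ioo a b, t ^ 2 * G t := by
  have hv : (volume : Measure E3).real (Metric.ball 0 1) = Real.pi * 4 / 3 := by
    rw [Measure.real, EuclideanSpace.volume_ball_fin_three]
    simp
    positivity
  have hi : (ann a b).indicator (fun x => G ‖x‖) = fun x => (Ioo a b).indicator G ‖x‖ := rfl
  rw [← integral_indicator (isOpen_ann a b).measurableSet, hi,
    integral_fun_norm_addHaar volume ((Ioo a b).indicator G), hv, finrank_euclideanSpace_fin,
    ← integral_indicator measurableSet_Ioi, ← integral_indicator measurableSet_Ioo]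
  have : (Ioi (0 : ℝ)).indicator (fun y => y ^ (3 - 1) • (Ioo a b).indicator G y) =
      (Ioo a b).indicator fun t => t ^ 2 * G t := by
    funext t
    by_cases ht : t ∈ Ioo a b
    · have h0 : t ∈ Ioi (0 : ℝ) := ha.trans_lt ht.1
      simp [indicator_of_mem ht, indicator_of_mem h0]
    · rw [indicator_of_notMem ht, indicator_apply, indicator_of_notMem ht, smul_zero, ite_self]
  rw [this]
  simp only [nsmul_eq_mul, smul_eq_mul]
  push_cast
  ring

lemma integral_Ioo_two_add_div_sq {a b : ℝ} (ha : 0 < a) (hab : a < b) (k : ℝ) :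
    ∫ t in Ioo a b, (2 + k / t ^ 2) = 2 * (b - a) + k * (b - a) / (a * b) := by
  have h0 : ∀ t ∈ uIcc a b, t ≠ 0 := fun t ht =>
    (ha.trans_le (uIcc_of_le hab.le ▸ ht : t ∈ Icc a b).1).ne'
  rw [← integral_Ioc_eq_integral_Ioo, ← intervalIntegral.integral_of_le hab.le,
    intervalIntegral.integral_eq_sub_of_hasDerivAt (f := fun t => 2 * t - k * t⁻¹)]
  · have := ha.trans hab
    field_simp
    ring
  · intro t ht
    refine (((hasDerivAt_id t).const_mul 2).sub
      ((hasDerivAt_inv (h0 t ht)).const_mul k)).congr_deriv ?_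
    ring
  · apply ContinuousOn.intervalIntegrable
    exact continuousOn_const.add (continuousOn_const.div (continuousOn_id.pow 2)
      fun t ht => pow_ne_zero 2 (h0 t ht))

/-- The radial profile of the minimizer. -/
def profile (r R rs Rs t : ℝ) : ℝ := Rs * (rs / Rs) ^ (R * (t - r) / ((R - r) * t))

/-- The inverse of the radial profile. -/
def profileInv (r R rs Rs s : ℝ) : ℝ :=
  r / (1 - Real.log (s / Rs) / (Real.log (rs / Rs) * (R / (R - r))))

section profile

variable {r R rs Rs : ℝ}

lemma profile_pos (hrs : 0 < rs) (hRs : rs < Rs) (t : ℝ) : 0 < profile r R rs Rs t :=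
  mul_pos (hrs.trans hRs) (Real.rpow_pos_of_pos (div_pos hrs (hrs.trans hRs)) _)

lemma log_profile_div (hrs : 0 < rs) (hRs : rs < Rs) (t : ℝ) :
    Real.log (profile r R rs Rs t / Rs) =
      R * (t - r) / ((R - r) * t) * Real.log (rs / Rs) := by
  have hR := hrs.trans hRs
  rw [profile, mul_div_cancel_left₀ _ hR.ne', Real.log_rpow (div_pos hrs hR)]

lemma log_div_neg (hrs : 0 < rs) (hRs : rs < Rs) : Real.log (rs / Rs) < 0 :=
  Real.log_neg (div_pos hrs (hrs.trans hRs)) ((div_lt_one (hrs.trans hRs)).2 hRs)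

lemma mapsTo_profile (hr : 0 < r) (hrs : 0 < rs) (hRs : rs < Rs) :
    MapsTo (profile r R rs Rs) (Ioo r R) (Ioo rs Rs) := by
  rintro t ⟨h1, h2⟩
  have hR := hrs.trans hRs
  have hq : 0 < rs / Rs := div_pos hrs hR
  have hq1 : rs / Rs < 1 := (div_lt_one hR).2 hRs
  have ht : 0 < t := hr.trans h1
  have hd : 0 < (R - r) * t := mul_pos (by linarith) ht
  constructor
  · have : (rs / Rs) ^ (1 : ℝ) < (rs / Rs) ^ (R * (t - r) / ((R - r) * t)) := by
      apply Real.rpow_lt_rpow_of_exponent_gt hq hq1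
      rw [div_lt_one hd]
      nlinarith
    calc rs = Rs * (rs / Rs) ^ (1 : ℝ) := by rw [Real.rpow_one]; field_simp
      _ < _ := mul_lt_mul_of_pos_left this hR
  · have : (rs / Rs) ^ (R * (t - r) / ((R - r) * t)) < 1 :=
      Real.rpow_lt_one hq.le hq1 (div_pos (mul_pos (by linarith) (by linarith)) hd)
    calc _ < Rs * 1 := mul_lt_mul_of_pos_left this hR
      _ = Rs := mul_one _

lemma log_div_log_mem_Ioo (hrs : 0 < rs) {s : ℝ} (hs : s ∈ Ioo rs Rs) :
    Real.log (s / Rs) / Real.log (rs / Rs) ∈ Ioo (0 : ℝ) 1 := by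
  have hRs := hs.1.trans hs.2
  have hR := hrs.trans hRs
  have hL := log_div_neg hrs hRs
  have hs0 := hrs.trans hs.1
  refine ⟨div_pos_of_neg_of_neg (log_div_neg hs0 hs.2) hL, ?_⟩
  rw [div_lt_one_of_neg hL]
  exact Real.log_lt_log (div_pos hrs hR) (div_lt_div_of_pos_right hs.1 hR)

lemma profileInv_eq (s : ℝ) : profileInv r R rs Rs s =
    r / (1 - Real.log (s / Rs) / Real.log (rs / Rs) * ((R - r) / R)) := by
  rw [profileInv]
  congr 2
  rw [div_mul_eq_div_div, div_div_eq_mul_div, mul_div_assoc]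

lemma profileInv_denom_mem_Ioo (hr : 0 < r) (hrR : r < R) (hrs : 0 < rs) {s : ℝ}
    (hs : s ∈ Ioo rs Rs) :
    1 - Real.log (s / Rs) / Real.log (rs / Rs) * ((R - r) / R) ∈ Ioo (r / R) 1 := by
  obtain ⟨h0, h1⟩ := log_div_log_mem_Ioo hrs hs
  have hR := hr.trans hrR
  have hd : 0 < (R - r) / R := div_pos (by linarith) hR
  have he : r / R = 1 - (R - r) / R := by field_simp; ring
  constructor <;> nlinarith

lemma mapsTo_profileInv (hr : 0 < r) (hrR : r < R) (hrs : 0 < rs) :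
    MapsTo (profileInv r R rs Rs) (Ioo rs Rs) (Ioo r R) := by
  intro s hs
  obtain ⟨h0, h1⟩ := profileInv_denom_mem_Ioo hr hrR hrs hs
  have hR := hr.trans hrR
  rw [profileInv_eq]
  have hp := (div_pos hr hR).trans h0
  refine ⟨(lt_div_iff₀ hp).2 (by nlinarith), (div_lt_iff₀ hp).2 ?_⟩
  rw [div_lt_iff₀ hR] at h0
  linarith

lemma leftInvOn_profileInv (hr : 0 < r) (hrs : 0 < rs) (hRs : rs < Rs) :
    LeftInvOn (profileInv r R rs Rs) (profile r R rs Rs) (Ioo r R) := by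
  rintro t ⟨h1, h2⟩
  have hL := (log_div_neg hrs hRs).ne
  have ht : t ≠ 0 := (hr.trans h1).ne'
  have hR : R ≠ 0 := by linarith
  have hd : R - r ≠ 0 := by linarith
  rw [profileInv_eq, log_profile_div hrs hRs, mul_div_cancel_right₀ _ hL]
  have : 1 - R * (t - r) / ((R - r) * t) * ((R - r) / R) = r / t := by
    field_simp
    ring
  rw [this, div_div_cancel₀ hr.ne']

lemma rightInvOn_profileInv (hr : 0 < r) (hrR : r < R) (hrs : 0 < rs) :
    RightInvOn (profileInv r R rs Rs) (profile r R rs Rs) (Ioo rs Rs) := by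
  intro s hs
  have hRs := hs.1.trans hs.2
  have hRs0 := hrs.trans hRs
  have hL := (log_div_neg hrs hRs).ne
  have hR := hr.trans hrR
  have hd : R - r ≠ 0 := by linarith
  have hs0 : 0 < s / Rs := div_pos (hrs.trans hs.1) hRs0
  have hp := ((div_pos hr hR).trans (profileInv_denom_mem_Ioo hr hrR hrs hs).1).ne'
  set u := profileInv r R rs Rs s with hu
  have hu0 : u ≠ 0 := (hr.trans (mapsTo_profileInv hr hrR hrs hs).1).ne'
  have he : R * (u - r) / ((R - r) * u) = Real.log (s / Rs) / Real.log (rs / Rs) := by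
    have h1 : r / u = 1 - Real.log (s / Rs) / Real.log (rs / Rs) * ((R - r) / R) := by
      rw [hu, profileInv_eq, div_div_cancel₀ hr.ne']
    have h2 : R * (u - r) / ((R - r) * u) = (1 - r / u) * (R / (R - r)) := by
      field_simp
    rw [h2, h1]
    field_simp
    ring
  have hlog : Real.log (profile r R rs Rs u / Rs) = Real.log (s / Rs) := by
    rw [log_profile_div hrs hRs, he, div_mul_cancel₀ _ hL]
  exact (div_left_inj' hRs0.ne').1
    (Real.log_injOn_pos (div_pos (profile_pos hrs hRs u) hRs0) hs0 hlog)

lemma hasDerivAt_profile (hrR : r < R) (hrs : 0 < rs) (hRs : rs < Rs) {t : ℝ} (ht : t ≠ 0) :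
    HasDerivAt (profile r R rs Rs) (profile r R rs Rs t *
      (Real.log (rs / Rs) * (r * R / (R - r)) / t ^ 2)) t := by
  have hd : R - r ≠ 0 := by linarith
  have he : HasDerivAt (fun t => R * (t - r) / ((R - r) * t))
      (r * R / (R - r) / t ^ 2) t := by
    refine ((((hasDerivAt_id t).sub_const r).const_mul R).div
      ((hasDerivAt_id t).const_mul (R - r)) (mul_ne_zero hd ht)).congr_deriv ?_
    simp only [id]
    field_simp
    ring
  refine ((he.const_rpow (div_pos hrs (hrs.trans hRs))).const_mul Rs).congr_deriv ?_
  rw [profile]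
  ring

lemma contDiffOn_profile (hr : 0 < r) (hrs : 0 < rs) (hRs : rs < Rs) :
    ContDiffOn ℝ 1 (profile r R rs Rs) (Ioo r R) := by
  have hq := (div_pos hrs (hrs.trans hRs)).ne'
  refine contDiffOn_const.mul (contDiffOn_const.rpow (ContDiffOn.div ?_ ?_ ?_) fun _ _ => hq)
  · fun_prop
  · fun_prop
  · rintro t ⟨h1, h2⟩
    exact mul_ne_zero (by linarith) (by linarith)

lemma continuousOn_profileInv (hr : 0 < r) (hrR : r < R) (hrs : 0 < rs) :
    ContinuousOn (profileInv r R rs Rs) (Ioo rs Rs) := by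
  rw [show profileInv r R rs Rs = _ from funext profileInv_eq]
  refine continuousOn_const.div (continuousOn_const.sub
    (((ContinuousOn.log (continuousOn_id.div_const _) fun s hs => ?_).div_const _).mul_const _))
    fun s hs => ((div_pos hr (hr.trans hrR)).trans
      (profileInv_denom_mem_Ioo hr hrR hrs hs).1).ne'
  exact (div_pos (hrs.trans hs.1) (hrs.trans (hs.1.trans hs.2))).ne'

end profile

/-- the generalized radial map `f₂` is a `C¹` homeomorphism between the annuli
and attains the minimal weighted Dirichlet energy. -/
theorem stmt_1 (r R rs Rs : ℝ) (hr : 0 < r) (hrR : r < R) (hrs : 0 < rs) (hRs : rs < Rs)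
    (f₂ : E3 → E3)
    (hf₂ : ∀ x ∈ ann r R,
      f₂ x = (Rs * (rs / Rs) ^ (R * (‖x‖ - r) / ((R - r) * ‖x‖))) • (‖x‖⁻¹ • x)) :
    ContDiffOn ℝ 1 f₂ (ann r R) ∧
    Set.BijOn f₂ (ann r R) (ann rs Rs) ∧
    ContinuousOn (Function.invFunOn f₂ (ann r R)) (ann rs Rs) ∧
    ∫ x in ann r R, frobSq (fderiv ℝ f₂ x) / ‖f₂ x‖ ^ 2
      = 4 * Real.pi * (2 * (R - r) + r * R * (Real.log (Rs / rs)) ^ 2 / (R - r)) := by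
  have hE : EqOn f₂ (radialMap (profile r R rs Rs)) (ann r R) := hf₂
  have hmaps := mapsTo_profile (R := R) hr hrs hRs
  have hmaps' := mapsTo_profileInv (Rs := Rs) hr hrR hrs
  have hinv : InvOn (radialMap (profileInv r R rs Rs)) (radialMap (profile r R rs Rs))
      (ann r R) (ann rs Rs) :=
    ⟨leftInvOn_radialMap hr.le hrs.le hmaps (leftInvOn_profileInv hr hrs hRs),
      leftInvOn_radialMap hrs.le hr.le hmaps' (rightInvOn_profileInv hr hrR hrs)⟩
  have hmapsInv := mapsTo_radialMap hrs.le hr.le hmaps'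
  have hbij : BijOn f₂ (ann r R) (ann rs Rs) :=
    (hinv.bijOn (mapsTo_radialMap hr.le hrs.le hmaps) hmapsInv).congr hE.symm
  refine ⟨(contDiffOn_radialMap hr.le (contDiffOn_profile hr hrs hRs)).congr hE, hbij, ?_, ?_⟩
  · refine (continuousOn_radialMap hrs.le (continuousOn_profileInv hr hrR hrs)).congr ?_
    intro y hy
    have hz := hmapsInv hy
    have hfz : f₂ (radialMap (profileInv r R rs Rs) y) = y := (hE hz).trans (hinv.2 hy)
    have := hbij.injOn.leftInvOn_invFunOn hz
    rwa [hfz] at this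
  · have hint : ∀ x ∈ ann r R, frobSq (fderiv ℝ f₂ x) / ‖f₂ x‖ ^ 2 =
        (fun t => (Real.log (rs / Rs) * (r * R / (R - r)) / t ^ 2) ^ 2 + 2 / t ^ 2) ‖x‖ := by
      intro x hx
      have hx0 := ne_zero_of_mem_ann hr.le hx
      have hn : ‖x‖ ≠ 0 := norm_ne_zero_iff.2 hx0
      have hp := profile_pos (r := r) (R := R) hrs hRs ‖x‖
      have hfd := (hE.eventuallyEq_of_mem ((isOpen_ann r R).mem_nhds hx)).fderiv_eq (𝕜 := ℝ)
      rw [hfd, hE hx, norm_radialMap hx0 hp.le,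
        frobSq_fderiv_radialMap hx0 (hasDerivAt_profile hrR hrs hRs hn)]
      have hp' := hp.ne'
      generalize profile r R rs Rs ‖x‖ = p at hp'
      generalize Real.log (rs / Rs) * (r * R / (R - r)) = k
      field_simp
    have hG : ∀ t ∈ Ioo r R,
        t ^ 2 * ((Real.log (rs / Rs) * (r * R / (R - r)) / t ^ 2) ^ 2 + 2 / t ^ 2) =
          2 + (Real.log (rs / Rs) * (r * R / (R - r))) ^ 2 / t ^ 2 := by
      intro t ht
      have ht0 : t ≠ 0 := (hr.trans ht.1).ne'
      generalize Real.log (rs / Rs) * (r * R / (R - r)) = k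
      field_simp
      ring
    rw [setIntegral_congr_fun (isOpen_ann r R).measurableSet hint]
    refine (setIntegral_ann_fun_norm (b := R) hr.le
      fun t => (Real.log (rs / Rs) * (r * R / (R - r)) / t ^ 2) ^ 2 + 2 / t ^ 2).trans ?_
    rw [setIntegral_congr_fun measurableSet_Ioo hG, integral_Ioo_two_add_div_sq hr hrR,
      ← inv_div Rs rs, Real.log_inv]
    have hd : R - r ≠ 0 := by linarith
    have hR := hr.trans hrR
    generalize Real.log (Rs / rs) = L
    field_simp

end
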